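/- For every finite set A ⊂ ℝ^d there exists a triangulation T of conv(A) such that the vertex set of every simplex of T is an affinely independent subset of A, and such that for every face F of conv(A), the simplices of T contained in F form a triangulation of F all of whose vertices lie in A ∩ F. -/

import Mathlib

open Pointwise

/-- A point of `ℝ^d` with integer coordinates. -/
def IsLatticePt {d : ℕ} (x : Fin d → ℝ) : Prop := ∀ i, ∃ z : ℤ, x i = (z : ℝ)

/-- The subgroup `ℤ^d` of integral points of `ℝ^d`. -/
def intLattice (d : ℕ) : AddSubgroup (Fin d → ℝ) where
  carrier := {x | IsLatticePt x}
  zero_mem' := fun i => ⟨0, by simp⟩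
  add_mem' := by
    rintro a b ha hb i
    obtain ⟨z, hz⟩ := ha i
    obtain ⟨w, hw⟩ := hb i
    exact ⟨z + w, by simp [hz, hw]⟩
  neg_mem' := by
    rintro a ha i
    obtain ⟨z, hz⟩ := ha i
    exact ⟨-z, by simp [hz]⟩

/-- A polytope: the convex hull of a nonempty finite set of points. -/
def IsPolytope {d : ℕ} (P : Set (Fin d → ℝ)) : Prop :=
  ∃ V : Finset (Fin d → ℝ), V.Nonempty ∧ P = convexHull ℝ (V : Set (Fin d → ℝ))

/-- An integral polytope: the convex hull of a nonempty finite set of integral points. -/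
def IsIntegralPolytope {d : ℕ} (P : Set (Fin d → ℝ)) : Prop :=
  ∃ V : Finset (Fin d → ℝ), V.Nonempty ∧ (∀ v ∈ V, IsLatticePt v) ∧
    P = convexHull ℝ (V : Set (Fin d → ℝ))

/-- A simplex: the convex hull of a nonempty affinely independent finite set. -/
def IsSimplex {d : ℕ} (P : Set (Fin d → ℝ)) : Prop :=
  ∃ V : Finset (Fin d → ℝ), V.Nonempty ∧
    AffineIndependent ℝ (Subtype.val : ↥(V : Set (Fin d → ℝ)) → (Fin d → ℝ)) ∧
    P = convexHull ℝ (V : Set (Fin d → ℝ))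

/-- An integral simplex. -/
def IsIntegralSimplex {d : ℕ} (P : Set (Fin d → ℝ)) : Prop :=
  ∃ V : Finset (Fin d → ℝ), V.Nonempty ∧ (∀ v ∈ V, IsLatticePt v) ∧
    AffineIndependent ℝ (Subtype.val : ↥(V : Set (Fin d → ℝ)) → (Fin d → ℝ)) ∧
    P = convexHull ℝ (V : Set (Fin d → ℝ))

/-- The set of differences of vertices (= extreme points) of a polytope. -/
def vertexDiffs {d : ℕ} (P : Set (Fin d → ℝ)) : Set (Fin d → ℝ) :=
  {w | ∃ u ∈ P.extremePoints ℝ, ∃ v ∈ P.extremePoints ℝ, w = u - v}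

/-- `L(P)`: the subgroup of `ℤ^d` generated by differences of vertices of `P`. -/
def latL {d : ℕ} (P : Set (Fin d → ℝ)) : AddSubgroup (Fin d → ℝ) :=
  AddSubgroup.closure (vertexDiffs P)

/-- `N(P)`: the intersection of the real span of `L(P)` with `ℤ^d`. -/
def latN {d : ℕ} (P : Set (Fin d → ℝ)) : AddSubgroup (Fin d → ℝ) :=
  (Submodule.span ℝ (vertexDiffs P)).toAddSubgroup ⊓ intLattice d

/-- The (normalized) index of an integral polytope: the group index `[N(P) : L(P)]`. -/
noncomputable def polyIndex {d : ℕ} (P : Set (Fin d → ℝ)) : ℕ :=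
  ((latL P).addSubgroupOf (latN P)).index

/-- A unimodular simplex: an integral simplex of index 1. -/
def IsUnimodularSimplex {d : ℕ} (P : Set (Fin d → ℝ)) : Prop :=
  IsIntegralSimplex P ∧ polyIndex P = 1

/-- `F` is a face of `P`: the (nonempty) set of maximizers on `P` of a linear functional. -/
def IsFaceOf {d : ℕ} (F P : Set (Fin d → ℝ)) : Prop :=
  F.Nonempty ∧ ∃ φ : (Fin d → ℝ) →ₗ[ℝ] ℝ, F = {x ∈ P | ∀ y ∈ P, φ y ≤ φ x}

/-- A triangulation of `Q`: a finite, face-closed collection of simplices with union `Q`,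
any two of which meet in a (possibly empty) common face. -/
def IsTriangulation {d : ℕ} (T : Set (Set (Fin d → ℝ))) (Q : Set (Fin d → ℝ)) : Prop :=
  T.Finite ∧ (∀ S ∈ T, IsSimplex S) ∧ ⋃₀ T = Q ∧
    (∀ S ∈ T, ∀ F, IsFaceOf F S → F ∈ T) ∧
    ∀ S₁ ∈ T, ∀ S₂ ∈ T, S₁ ∩ S₂ = ∅ ∨ (IsFaceOf (S₁ ∩ S₂) S₁ ∧ IsFaceOf (S₁ ∩ S₂) S₂)

/-- A unimodular triangulation: all of its simplices are unimodular. -/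
def IsUnimodularTriangulation {d : ℕ} (T : Set (Set (Fin d → ℝ))) (Q : Set (Fin d → ℝ)) : Prop :=
  IsTriangulation T Q ∧ ∀ S ∈ T, IsUnimodularSimplex S

open Finset in
/-- A point of the convex hull of `a '' B` is a convex combination with weights supported on `B`. -/
theorem mem_convexHull_image_iff_exists_weights {ι E : Type*} [Fintype ι] [AddCommGroup E]
    [Module ℝ E] (a : ι → E) (B : Set ι) (x : E) :
    x ∈ convexHull ℝ (a '' B) ↔ ∃ w : ι → ℝ, (∀ i, 0 ≤ w i) ∧ (∀ i, i ∉ B → w i = 0) ∧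
      ∑ i, w i = 1 ∧ ∑ i, w i • a i = x := by
  classical
  constructor
  · intro hx
    have hsub : convexHull ℝ (a '' B) ⊆ {x | ∃ w : ι → ℝ, (∀ i, 0 ≤ w i) ∧
        (∀ i, i ∉ B → w i = 0) ∧ ∑ i, w i = 1 ∧ ∑ i, w i • a i = x} := by
      refine convexHull_min ?_ ?_
      · rintro _ ⟨i, hi, rfl⟩
        refine ⟨Pi.single i 1, fun j => ?_, fun j hj => ?_, by simp, ?_⟩
        · by_cases h : j = i
          · subst h; simp
          · simp [h]
        · exact Pi.single_eq_of_ne (M := fun _ : ι => ℝ) (fun h : j = i => hj (h.symm ▸ hi)) 1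
        · simp [Pi.single_apply, ite_smul]
      · rintro _ ⟨w, hw0, hwB, hw1, rfl⟩ _ ⟨v, hv0, hvB, hv1, rfl⟩ s t hs ht hst
        refine ⟨fun i => s * w i + t * v i, fun i => ?_, fun i hi => ?_, ?_, ?_⟩
        · have := hw0 i
          have := hv0 i
          positivity
        · simp [hwB i hi, hvB i hi]
        · rw [sum_add_distrib, ← mul_sum, ← mul_sum, hw1, hv1]
          linarith
        · simp only [add_smul, mul_smul, sum_add_distrib, ← smul_sum]
    exact hsub hx
  · rintro ⟨w, hw0, hwB, hw1, rfl⟩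
    have hsum : ∑ i with i ∈ B, w i = 1 := by
      rw [← hw1, sum_filter]
      exact sum_congr rfl fun i _ => by
        split_ifs with h
        · rfl
        · exact (hwB i h).symm
    have hpt : ∑ i, w i • a i = ∑ i with i ∈ B, w i • a i := by
      rw [sum_filter]
      exact sum_congr rfl fun i _ => by
        split_ifs with h
        · rfl
        · simp [hwB i h]
    rw [hpt]
    exact (convex_convexHull ℝ _).sum_mem (fun i _ => hw0 i) hsum fun i hi =>
      subset_convexHull ℝ _ ⟨i, (mem_filter.1 hi).2, rfl⟩

/-- The first nonzero coordinate of `δ` exists and is negative. -/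
def LexNeg {ι : Type*} [LinearOrder ι] (δ : ι → ℝ) : Prop :=
  ∃ i, (∀ j < i, δ j = 0) ∧ δ i < 0

theorem lexNeg_or_lexNeg_neg {ι : Type*} [LinearOrder ι] [Finite ι] {δ : ι → ℝ}
    (h : δ ≠ 0) : LexNeg δ ∨ LexNeg (-δ) := by
  obtain ⟨k, hk⟩ := Function.ne_iff.1 h
  obtain ⟨i, hi, hmin⟩ := WellFounded.has_min (wellFounded_lt (α := ι)) {i | δ i ≠ 0} ⟨k, hk⟩
  have hz : ∀ j < i, δ j = 0 := fun j hj => by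
    by_contra hne
    exact hmin j hne hj
  rcases lt_or_gt_of_ne hi with hlt | hgt
  · exact Or.inl ⟨i, hz, hlt⟩
  · exact Or.inr ⟨i, fun j hj => by simp [hz j hj], by simpa using hgt⟩

theorem LexNeg.smul {ι : Type*} [LinearOrder ι] {δ : ι → ℝ} (h : LexNeg δ) {ε : ℝ}
    (hε : 0 < ε) : LexNeg (ε • δ) := by
  obtain ⟨i, hz, hi⟩ := h
  exact ⟨i, fun j hj => by simp [hz j hj], by simpa using mul_neg_of_pos_of_neg hε hi⟩

/-- A nonempty compact set in `ℝⁿ` has a lexicographically minimal point. -/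
theorem IsCompact.exists_not_lexNeg_sub {n : ℕ} {K : Set (Fin n → ℝ)} (hK : IsCompact K)
    (hne : K.Nonempty) : ∃ w ∈ K, ∀ y ∈ K, ¬ LexNeg (y - w) := by
  have key : ∀ m : ℕ, ∃ w ∈ K, ∀ y ∈ K, ∀ i : Fin n, (i : ℕ) < m →
      (∀ j < i, y j = w j) → w i ≤ y i := by
    intro m
    induction m with
    | zero =>
      obtain ⟨w, hw⟩ := hne
      exact ⟨w, hw, fun _ _ _ h => absurd h (Nat.not_lt_zero _)⟩
    | succ m ih =>
      obtain ⟨w, hw, hmin⟩ := ih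
      by_cases hm : m < n
      · have hclosed : IsClosed {y : Fin n → ℝ | ∀ j < (⟨m, hm⟩ : Fin n), y j = w j} := by
          simp only [Set.ofPred_forall]
          exact isClosed_iInter fun j => isClosed_iInter fun _ =>
            isClosed_eq (continuous_apply j) continuous_const
        obtain ⟨v, ⟨hvK, hv⟩, hvmin⟩ := (hK.inter_right hclosed).exists_isMinOn
          ⟨w, hw, fun _ _ => rfl⟩ (continuous_apply (⟨m, hm⟩ : Fin n)).continuousOn
        refine ⟨v, hvK, fun y hy i hi hyv => ?_⟩
        rcases Nat.lt_succ_iff_lt_or_eq.1 hi with hlt | heq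
        · rw [hv i hlt]
          exact hmin y hy i hlt fun j hj => (hyv j hj).trans (hv j (hj.trans hlt))
        · obtain rfl : i = ⟨m, hm⟩ := Fin.ext heq
          exact hvmin ⟨hy, fun j hj => (hyv j hj).trans (hv j hj)⟩
      · exact ⟨w, hw, fun y hy i _ => hmin y hy i (i.2.trans_le (not_lt.1 hm))⟩
  obtain ⟨w, hw, hmin⟩ := key n
  refine ⟨w, hw, fun y hy => ?_⟩
  rintro ⟨i, hz, hi⟩
  have h := hmin y hy i i.2 fun j hj => sub_eq_zero.1 (hz j hj)
  exact absurd hi (not_lt.2 (sub_nonneg.2 h))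

/-- `B` is lexicographically minimal: no affine dependence of `a` that is nonnegative outside `B`
is lexicographically negative, i.e. convex combinations supported on `B` cannot be improved. -/
def IsLexMinimal {ι E : Type*} [Fintype ι] [LinearOrder ι] [AddCommGroup E] [Module ℝ E]
    (a : ι → E) (B : Set ι) : Prop :=
  ∀ δ : ι → ℝ, ∑ i, δ i = 0 → ∑ i, δ i • a i = 0 → (∀ i, i ∉ B → 0 ≤ δ i) → ¬ LexNeg δ

section IsLexMinimal

variable {ι E : Type*} [Fintype ι] [LinearOrder ι] [AddCommGroup E] [Module ℝ E]
  {a : ι → E} {B C : Set ι}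

theorem IsLexMinimal.mono (hB : IsLexMinimal a B) (h : C ⊆ B) : IsLexMinimal a C :=
  fun δ h0 h1 h2 => hB δ h0 h1 fun i hi => h2 i fun hc => hi (h hc)

/-- Weights supported on lexicographically minimal sets are determined by the point. -/
theorem IsLexMinimal.weights_unique (hB : IsLexMinimal a B) (hC : IsLexMinimal a C)
    {w v : ι → ℝ} (hw0 : ∀ i, 0 ≤ w i) (hv0 : ∀ i, 0 ≤ v i) (hwB : ∀ i, i ∉ B → w i = 0)
    (hvC : ∀ i, i ∉ C → v i = 0) (hsum : ∑ i, w i = ∑ i, v i)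
    (hpt : ∑ i, w i • a i = ∑ i, v i • a i) : w = v := by
  by_contra hne
  rcases lexNeg_or_lexNeg_neg (sub_ne_zero.2 hne) with h | h
  · refine hC (w - v) ?_ ?_ (fun i hi => ?_) h
    · simp [hsum]
    · simp [sub_smul, hpt]
    · simpa [hvC i hi] using hw0 i
  · rw [neg_sub] at h
    refine hB (v - w) ?_ ?_ (fun i hi => ?_) h
    · simp [hsum]
    · simp [sub_smul, hpt]
    · simpa [hwB i hi] using hv0 i

theorem IsLexMinimal.eq_zero (hB : IsLexMinimal a B) {δ : ι → ℝ} (hδ : ∀ i, i ∉ B → δ i = 0)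
    (hsum : ∑ i, δ i = 0) (hpt : ∑ i, δ i • a i = 0) : δ = 0 := by
  by_contra hne
  rcases lexNeg_or_lexNeg_neg hne with h | h
  · exact hB δ hsum hpt (fun i hi => (hδ i hi).ge) h
  · exact hB (-δ) (by simp [hsum]) (by simp [hpt]) (fun i hi => by simp [hδ i hi]) h

theorem IsLexMinimal.linearIndependent (hB : IsLexMinimal a B) :
    LinearIndependent ℝ (fun i : B => (a i, (1 : ℝ))) := by
  classical
  rw [Fintype.linearIndependent_iff]
  intro g hg i
  have hg1 : ∑ i, g i • a i = 0 := by simpa [Prod.fst_sum] using congrArg Prod.fst hg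
  have hg2 : ∑ i, g i = 0 := by simpa [Prod.snd_sum] using congrArg Prod.snd hg
  let δ : ι → ℝ := fun j => if h : j ∈ B then g ⟨j, h⟩ else 0
  have hδ : ∀ j : B, δ j = g j := fun j => by simp [δ]
  have hδ0 : ∀ j, j ∉ B → δ j = 0 := fun j hj => by simp [δ, hj]
  have hδ0' : ∀ j : {j // j ∉ B}, δ j = 0 := fun j => hδ0 j j.2
  have hzero : δ = 0 := by
    refine hB.eq_zero hδ0 ?_ ?_
    · rw [← hg2, ← Fintype.sum_subtype_add_sum_subtype (· ∈ B) δ]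
      simp only [hδ0' _, Finset.sum_const_zero, add_zero]
      exact Finset.sum_congr rfl fun j _ => hδ j
    · rw [← hg1, ← Fintype.sum_subtype_add_sum_subtype (· ∈ B) fun i => δ i • a i]
      simp only [hδ0' _, zero_smul, Finset.sum_const_zero, add_zero]
      exact Finset.sum_congr rfl fun j _ => by rw [← hδ j]
  rw [← hδ i, hzero, Pi.zero_apply]

theorem IsLexMinimal.affineIndependent (hB : IsLexMinimal a B) :
    AffineIndependent ℝ (fun i : B => a i) := by
  rw [affineIndependent_iff]
  intro s w hw hwa i hi
  refine linearIndependent_iff'.1 hB.linearIndependent s w ?_ i hi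
  refine Prod.ext ?_ ?_
  · simpa [Prod.fst_sum] using hwa
  · simpa [Prod.snd_sum] using hw

theorem IsLexMinimal.affineIndependent_image (hB : IsLexMinimal a B) :
    AffineIndependent ℝ (Subtype.val : ↥(a '' B) → E) := by
  have h := hB.affineIndependent.range
  rwa [Set.image_eq_range]

theorem IsLexMinimal.convexHull_inter (hB : IsLexMinimal a B) (hC : IsLexMinimal a C) :
    convexHull ℝ (a '' B) ∩ convexHull ℝ (a '' C) = convexHull ℝ (a '' (B ∩ C)) := by
  refine Set.Subset.antisymm ?_ (Set.subset_inter
    (convexHull_mono (Set.image_mono Set.inter_subset_left))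
    (convexHull_mono (Set.image_mono Set.inter_subset_right)))
  rintro x ⟨hx, hx'⟩
  obtain ⟨w, hw0, hwB, hw1, hwx⟩ := (mem_convexHull_image_iff_exists_weights a B x).1 hx
  obtain ⟨v, hv0, hvC, hv1, hvx⟩ := (mem_convexHull_image_iff_exists_weights a C x).1 hx'
  obtain rfl : w = v := hB.weights_unique hC hw0 hv0 hwB hvC (hw1.trans hv1.symm)
    (hwx.trans hvx.symm)
  refine (mem_convexHull_image_iff_exists_weights a _ x).2 ⟨w, hw0, fun i hi => ?_, hw1, hwx⟩
  by_cases hiB : i ∈ B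
  · exact hvC i fun hiC => hi ⟨hiB, hiC⟩
  · exact hwB i hiB

end IsLexMinimal

/-- Every point of the convex hull lies in the relative interior of a lexicographically minimal
simplex. -/
theorem exists_isLexMinimal_weights {n d : ℕ} (a : Fin n → Fin d → ℝ) {x : Fin d → ℝ}
    (hx : x ∈ convexHull ℝ (Set.range a)) :
    ∃ w : Fin n → ℝ, (∀ i, 0 ≤ w i) ∧ ∑ i, w i = 1 ∧ ∑ i, w i • a i = x ∧
      IsLexMinimal a {i | w i ≠ 0} := by
  let K : Set (Fin n → ℝ) := stdSimplex ℝ (Fin n) ∩ {w | ∑ i, w i • a i = x}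
  have hK : IsCompact K := (isCompact_stdSimplex ℝ (Fin n)).inter_right
    (isClosed_eq (by fun_prop) continuous_const)
  have hne : K.Nonempty := by
    rw [← Set.image_univ, mem_convexHull_image_iff_exists_weights] at hx
    obtain ⟨w, hw0, -, hw1, hwx⟩ := hx
    exact ⟨w, ⟨hw0, hw1⟩, hwx⟩
  obtain ⟨w, ⟨⟨hw0, hw1⟩, hwx : ∑ i, w i • a i = x⟩, hmin⟩ := hK.exists_not_lexNeg_sub hne
  refine ⟨w, hw0, hw1, hwx, fun δ hδ hδa hpos hneg => ?_⟩
  have hev : ∀ i, ∀ᶠ ε in nhdsWithin (0 : ℝ) (Set.Ioi 0), 0 ≤ w i + ε * δ i := by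
    intro i
    by_cases hi : w i = 0
    · filter_upwards [self_mem_nhdsWithin] with ε hε
      have := hpos i (by simpa using hi)
      have : 0 < ε := hε
      rw [hi]
      positivity
    · have hcont : Continuous fun ε : ℝ => w i + ε * δ i := by fun_prop
      have hlim := hcont.tendsto 0
      have hwi : 0 < w i + 0 * δ i := by simpa using (hw0 i).lt_of_ne' hi
      exact ((hlim.eventually (lt_mem_nhds hwi)).filter_mono nhdsWithin_le_nhds).mono
        fun _ h => h.le
  obtain ⟨ε, hε, hε0⟩ := ((Filter.eventually_all.2 hev).and self_mem_nhdsWithin).exists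
  refine hmin (w + ε • δ) ⟨⟨fun i => by simpa using hε i, ?_⟩, ?_⟩ ?_
  · simp [Finset.sum_add_distrib, ← Finset.mul_sum, hw1, hδ]
  · simp [add_smul, mul_smul, Finset.sum_add_distrib, ← Finset.smul_sum, hwx, hδa]
  · simpa using hneg.smul hε0

theorem IsFaceOf.subset {d : ℕ} {F P : Set (Fin d → ℝ)} (h : IsFaceOf F P) : F ⊆ P := by
  obtain ⟨-, φ, rfl⟩ := h
  exact Set.sep_subset _ _

theorem IsFaceOf.convex {d : ℕ} {F P : Set (Fin d → ℝ)} (h : IsFaceOf F P) (hP : Convex ℝ P) :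
    Convex ℝ F := by
  obtain ⟨-, φ, rfl⟩ := h
  intro x hx y hy s t hs ht hst
  refine ⟨hP hx.1 hy.1 hs ht hst, fun z hz => ?_⟩
  rw [map_add, map_smul, map_smul, smul_eq_mul, smul_eq_mul]
  calc φ z = s * φ z + t * φ z := by rw [← add_mul, hst, one_mul]
    _ ≤ s * φ x + t * φ y := by gcongr; exacts [hx.2 z hz, hy.2 z hz]

/-- The points of `P` used with positive weight to represent a point of a face lie in the face. -/
theorem IsFaceOf.mem_of_weight_ne_zero {ι : Type*} [Fintype ι] {d : ℕ} {F P : Set (Fin d → ℝ)}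
    (h : IsFaceOf F P) {a : ι → Fin d → ℝ} {w : ι → ℝ} (ha : ∀ i, w i ≠ 0 → a i ∈ P)
    (hw0 : ∀ i, 0 ≤ w i) (hw1 : ∑ i, w i = 1) (hF : ∑ i, w i • a i ∈ F) (i : ι)
    (hi : w i ≠ 0) : a i ∈ F := by
  obtain ⟨-, φ, rfl⟩ := h
  obtain ⟨-, hmax⟩ := hF
  set M := φ (∑ i, w i • a i) with hM
  have hle : ∀ j, 0 ≤ w j * (M - φ (a j)) := fun j => by
    by_cases hj : w j = 0
    · simp [hj]
    · exact mul_nonneg (hw0 j) (sub_nonneg.2 (hmax _ (ha j hj)))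
  have hsum : ∑ j, w j * (M - φ (a j)) = 0 := by
    simp only [mul_sub, Finset.sum_sub_distrib, ← Finset.sum_mul, hw1]
    simp [hM]
  have hzero := (Finset.sum_eq_zero_iff_of_nonneg fun j _ => hle j).1 hsum i (Finset.mem_univ i)
  have heq : M - φ (a i) = 0 := (mul_eq_zero.1 hzero).resolve_left hi
  exact ⟨ha i hi, fun y hy => (hmax y hy).trans (sub_eq_zero.1 heq).le⟩

/-- A face of a polytope is the convex hull of the given points it contains. -/
theorem IsFaceOf.eq_convexHull {ι : Type*} [Fintype ι] {d : ℕ} {a : ι → Fin d → ℝ} {B : Set ι}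
    {F : Set (Fin d → ℝ)} (h : IsFaceOf F (convexHull ℝ (a '' B))) :
    F = convexHull ℝ (a '' {i ∈ B | a i ∈ F}) := by
  refine Set.Subset.antisymm (fun x hx => ?_) (convexHull_min ?_ (h.convex (convex_convexHull ℝ _)))
  · obtain ⟨w, hw0, hwB, hw1, rfl⟩ :=
      (mem_convexHull_image_iff_exists_weights a B x).1 (h.subset hx)
    refine (mem_convexHull_image_iff_exists_weights a _ _).2 ⟨w, hw0, fun i hi => ?_, hw1, rfl⟩
    by_contra hne
    have hmem : ∀ j, w j ≠ 0 → j ∈ B := fun j hj => by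
      by_contra hjB
      exact hj (hwB j hjB)
    exact hi ⟨hmem i hne, h.mem_of_weight_ne_zero
      (fun j hj => subset_convexHull ℝ _ ⟨j, hmem j hj, rfl⟩) hw0 hw1 hx i hne⟩
  · rintro _ ⟨i, hi, rfl⟩
    exact hi.2

/-- The convex hull of a nonempty set of vertices of a lexicographically minimal simplex is a
face. -/
theorem IsLexMinimal.isFaceOf {ι : Type*} [Fintype ι] [LinearOrder ι] {d : ℕ}
    {a : ι → Fin d → ℝ} {B C : Set ι} (hB : IsLexMinimal a B) (hCB : C ⊆ B) (hC : C.Nonempty) :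
    IsFaceOf (convexHull ℝ (a '' C)) (convexHull ℝ (a '' B)) := by
  classical
  obtain ⟨f, hf⟩ : ∃ f : (Fin d → ℝ) × ℝ →ₗ[ℝ] ℝ,
      ∀ i ∈ B, f (a i, 1) = if i ∈ C then 0 else -1 := by
    obtain ⟨g, hg⟩ := LinearMap.exists_leftInverse_of_injective
      (Finsupp.linearCombination ℝ fun i : B => (a i, (1 : ℝ)))
      (LinearMap.ker_eq_bot.2 hB.linearIndependent)
    refine ⟨Finsupp.linearCombination ℝ (fun i : B => if (i : ι) ∈ C then (0 : ℝ) else -1) ∘ₗ g,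
      fun i hi => ?_⟩
    have h : g (a i, 1) = Finsupp.single ⟨i, hi⟩ 1 := by
      simpa using LinearMap.congr_fun hg (Finsupp.single ⟨i, hi⟩ 1)
    simp [h]
  have hsplit : ∀ w : ι → ℝ, (∀ i, i ∉ B → w i = 0) → ∑ i, w i = 1 →
      f (∑ i, w i • a i, 1) = -∑ i with i ∉ C, w i := by
    intro w hw hw1
    have : (∑ i, w i • a i, (1 : ℝ)) = ∑ i, w i • (a i, (1 : ℝ)) := by
      ext <;> simp [Prod.fst_sum, Prod.snd_sum, hw1]
    rw [this, map_sum, Finset.sum_filter, ← Finset.sum_neg_distrib]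
    refine Finset.sum_congr rfl fun i _ => ?_
    by_cases hi : i ∈ B
    · rw [map_smul, hf i hi]
      split_ifs <;> simp
    · simp [hw i hi]
  have hf1 : ∀ x, f (x, 1) = f (x, 0) + f (0, 1) := fun x => by rw [← map_add]; simp
  refine ⟨(hC.image a).convexHull, f ∘ₗ LinearMap.inl ℝ _ _, ?_⟩
  have hle : ∀ x ∈ convexHull ℝ (a '' B), f (x, 1) ≤ 0 := by
    intro x hx
    obtain ⟨w, hw0, hwB, hw1, rfl⟩ := (mem_convexHull_image_iff_exists_weights a B x).1 hx
    rw [hsplit w hwB hw1]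
    exact neg_nonpos.2 (Finset.sum_nonneg fun i _ => hw0 i)
  have hmem : ∀ x ∈ convexHull ℝ (a '' C), f (x, 1) = 0 := by
    intro x hx
    obtain ⟨w, hw0, hwC, hw1, rfl⟩ := (mem_convexHull_image_iff_exists_weights a C x).1 hx
    rw [hsplit w (fun i hi => hwC i fun h => hi (hCB h)) hw1,
      Finset.sum_eq_zero fun i hi => hwC i (Finset.mem_filter.1 hi).2, neg_zero]
  ext x
  constructor
  · intro hx
    refine ⟨convexHull_mono (Set.image_mono hCB) hx, fun y hy => ?_⟩
    have h1 := hmem x hx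
    have h2 := hle y hy
    rw [hf1] at h1 h2
    simp only [LinearMap.comp_apply, LinearMap.inl_apply]
    linarith
  · rintro ⟨hx, hmax⟩
    obtain ⟨i, hi⟩ := hC
    have h1 := hmax (a i) (subset_convexHull ℝ _ ⟨i, hCB hi, rfl⟩)
    have h2 := hmem (a i) (subset_convexHull ℝ _ ⟨i, hi, rfl⟩)
    obtain ⟨w, hw0, hwB, hw1, rfl⟩ := (mem_convexHull_image_iff_exists_weights a B x).1 hx
    have h3 := hsplit w hwB hw1
    rw [hf1] at h2 h3
    simp only [LinearMap.comp_apply, LinearMap.inl_apply] at h1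
    have hnn : ∀ j ∈ Finset.univ.filter (· ∉ C), 0 ≤ w j := fun j _ => hw0 j
    have hsum : ∑ j with j ∉ C, w j = 0 :=
      le_antisymm (by linarith) (Finset.sum_nonneg hnn)
    refine (mem_convexHull_image_iff_exists_weights a C _).2 ⟨w, hw0, fun j hj => ?_, hw1, rfl⟩
    exact (Finset.sum_eq_zero_iff_of_nonneg hnn).1 hsum j (by simpa using hj)

/-- The simplices spanned by the nonempty lexicographically minimal subfamilies of `a`. -/
def lexSimplices {n d : ℕ} (a : Fin n → Fin d → ℝ) : Set (Set (Fin d → ℝ)) :=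
  {S | ∃ B : Set (Fin n), B.Nonempty ∧ IsLexMinimal a B ∧ S = convexHull ℝ (a '' B)}

theorem finite_lexSimplices {n d : ℕ} (a : Fin n → Fin d → ℝ) : (lexSimplices a).Finite := by
  refine (Set.finite_range fun B : Set (Fin n) => convexHull ℝ (a '' B)).subset ?_
  rintro S ⟨B, -, -, rfl⟩
  exact ⟨B, rfl⟩

theorem exists_vertices_of_mem_lexSimplices {n d : ℕ} {a : Fin n → Fin d → ℝ}
    {S : Set (Fin d → ℝ)} (hS : S ∈ lexSimplices a) :
    ∃ V : Finset (Fin d → ℝ), (V : Set (Fin d → ℝ)) ⊆ Set.range a ∧ V.Nonempty ∧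
      AffineIndependent ℝ (Subtype.val : ↥(V : Set (Fin d → ℝ)) → (Fin d → ℝ)) ∧
      S = convexHull ℝ (V : Set (Fin d → ℝ)) := by
  obtain ⟨B, hne, hB, rfl⟩ := hS
  have hV : (((a '' B).toFinite.toFinset : Finset (Fin d → ℝ)) : Set (Fin d → ℝ)) = a '' B :=
    Set.Finite.coe_toFinset _
  refine ⟨(a '' B).toFinite.toFinset, ?_, ?_, ?_, ?_⟩
  · rw [hV]
    exact Set.image_subset_range a B
  · rw [← Finset.coe_nonempty, hV]
    exact hne.image a
  · rw [hV]
    exact hB.affineIndependent_image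
  · rw [hV]

/-- The lexicographically minimal simplices contained in a face triangulate it. -/
theorem isTriangulation_lexSimplices_face {n d : ℕ} (a : Fin n → Fin d → ℝ)
    {F : Set (Fin d → ℝ)} (hF : IsFaceOf F (convexHull ℝ (Set.range a))) :
    IsTriangulation {S | S ∈ lexSimplices a ∧ S ⊆ F} F := by
  refine ⟨(finite_lexSimplices a).subset (Set.sep_subset _ _), ?_, ?_, ?_, ?_⟩
  · rintro S ⟨hS, -⟩
    obtain ⟨V, -, hV⟩ := exists_vertices_of_mem_lexSimplices hS
    exact ⟨V, hV⟩
  · refine Set.Subset.antisymm (Set.sUnion_subset fun S hS => hS.2) fun x hx => ?_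
    obtain ⟨w, hw0, hw1, rfl, hmin⟩ := exists_isLexMinimal_weights a (hF.subset hx)
    refine ⟨convexHull ℝ (a '' {i | w i ≠ 0}), ⟨⟨_, ?_, hmin, rfl⟩, ?_⟩, ?_⟩
    · by_contra hempty
      have hz : ∀ i, w i = 0 := fun i => by
        by_contra hi
        exact hempty ⟨i, hi⟩
      simp [hz] at hw1
    · refine convexHull_min ?_ (hF.convex (convex_convexHull ℝ _))
      rintro _ ⟨i, hi, rfl⟩
      exact hF.mem_of_weight_ne_zero (fun j _ => subset_convexHull ℝ _ ⟨j, rfl⟩) hw0 hw1 hx i hi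
    · exact (mem_convexHull_image_iff_exists_weights a _ _).2
        ⟨w, hw0, fun i hi => by simpa using hi, hw1, rfl⟩
  · rintro _ ⟨⟨B, -, hB, rfl⟩, hBF⟩ G hG
    refine ⟨⟨_, ?_, hB.mono (Set.sep_subset B fun i => a i ∈ G), hG.eq_convexHull⟩,
      hG.subset.trans hBF⟩
    have hne := hG.1
    rw [hG.eq_convexHull, convexHull_nonempty_iff] at hne
    exact hne.of_image
  · rintro _ ⟨⟨B, -, hB, rfl⟩, -⟩ _ ⟨⟨C, -, hC, rfl⟩, -⟩
    rw [hB.convexHull_inter hC]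
    rcases (B ∩ C).eq_empty_or_nonempty with h | h
    · simp [h]
    · exact Or.inr ⟨hB.isFaceOf Set.inter_subset_left h, hC.isFaceOf Set.inter_subset_right h⟩

theorem isTriangulation_lexSimplices {n d : ℕ} (a : Fin n → Fin d → ℝ)
    (hne : (Set.range a).Nonempty) :
    IsTriangulation (lexSimplices a) (convexHull ℝ (Set.range a)) := by
  have h := isTriangulation_lexSimplices_face a
    (F := convexHull ℝ (Set.range a)) ⟨hne.convexHull, 0, by simp⟩
  have heq : {S | S ∈ lexSimplices a ∧ S ⊆ convexHull ℝ (Set.range a)} = lexSimplices a := by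
    refine Set.sep_eq_self_iff_mem_true.2 ?_
    rintro _ ⟨B, -, -, rfl⟩
    exact convexHull_mono (Set.image_subset_range a B)
  rwa [heq] at h

theorem statement8 (d : ℕ) (A : Finset (Fin d → ℝ)) (hA : A.Nonempty) :
    ∃ T : Set (Set (Fin d → ℝ)),
      IsTriangulation T (convexHull ℝ (A : Set (Fin d → ℝ))) ∧
      (∀ S ∈ T, ∃ B : Finset (Fin d → ℝ), (B : Set (Fin d → ℝ)) ⊆ (A : Set (Fin d → ℝ)) ∧
        B.Nonempty ∧ AffineIndependent ℝ (Subtype.val : ↥(B : Set (Fin d → ℝ)) → (Fin d → ℝ)) ∧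
        S = convexHull ℝ (B : Set (Fin d → ℝ))) ∧
      (∀ F, IsFaceOf F (convexHull ℝ (A : Set (Fin d → ℝ))) →
        IsTriangulation {S | S ∈ T ∧ S ⊆ F} F ∧
        ∀ S ∈ T, S ⊆ F → ∃ B : Finset (Fin d → ℝ),
          (B : Set (Fin d → ℝ)) ⊆ (A : Set (Fin d → ℝ)) ∩ F ∧ B.Nonempty ∧
          AffineIndependent ℝ (Subtype.val : ↥(B : Set (Fin d → ℝ)) → (Fin d → ℝ)) ∧
          S = convexHull ℝ (B : Set (Fin d → ℝ))) := by
  obtain ⟨n, a, ha⟩ : ∃ (n : ℕ) (a : Fin n → Fin d → ℝ), Set.range a = (A : Set (Fin d → ℝ)) :=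
    ⟨A.card, fun i => A.equivFin.symm i, by
      exact (A.equivFin.symm.surjective.range_comp (Subtype.val : A → Fin d → ℝ)).trans
        Subtype.range_coe⟩
  rw [← ha]
  refine ⟨lexSimplices a, isTriangulation_lexSimplices a (by rw [ha]; exact hA),
    fun S hS => exists_vertices_of_mem_lexSimplices hS,
    fun F hF => ⟨isTriangulation_lexSimplices_face a hF, fun S hS hSF => ?_⟩⟩
  obtain ⟨V, hVa, hne, hV, rfl⟩ := exists_vertices_of_mem_lexSimplices hS
  exact ⟨V, Set.subset_inter hVa ((subset_convexHull ℝ _).trans hSF), hne, hV, rfl⟩
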